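/- arXiv:2509.08898 — 7 statements merged into one kernel-verified Lean document; each statement's English description precedes it below -/
import Mathlib

section
/- For every natural number n ≥ 1 and every permutation p of Fin (2*n), there exist permutations q and r of Fin (2*n) such that p = q ∘ r, where r maps the set {i : (i : ℕ) < n} onto itself (and hence also maps {i : n ≤ (i : ℕ)} onto itself), and q is an interleave with respect to the split at n. -/
/-- Sorting the values of `p` separately on `{i | i < a}` and on its complement yields a
permutation `σ` that preserves the two blocks and makes `p ∘ σ` strictly increasing on each. -/
theorem exists_perm_strictMonoOn_blocks {N : ℕ} (a : ℕ) (p : Equiv.Perm (Fin N)) :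
    ∃ σ : Equiv.Perm (Fin N), (∀ i, a ≤ (σ i : ℕ) ↔ a ≤ (i : ℕ)) ∧
      ∀ i j : Fin N, (a ≤ (i : ℕ) ↔ a ≤ (j : ℕ)) → i < j → p (σ i) < p (σ j) := by
  let block : Fin N → Prop := fun i => a ≤ (i : ℕ)
  let key : Fin N → Prop ×ₗ Fin N := fun i => toLex (block i, p i)
  have hkey : Monotone (key ∘ Tuple.sort key) := Tuple.monotone_sort key
  have hblock : block ∘ Tuple.sort key = block := by
    refine Tuple.unique_monotone (f := block) (σ := Tuple.sort key) (τ := 1) ?_ ?_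
    · exact fun i j hij => Prod.Lex.monotone_fst _ _ (hkey hij)
    · exact fun i j hij hi => le_trans hi hij
  refine ⟨Tuple.sort key, fun i => iff_of_eq (congrFun hblock i), fun i j hb hij => ?_⟩
  have hb' : block (Tuple.sort key i) = block (Tuple.sort key j) :=
    (congrFun hblock i).trans ((propext hb).trans (congrFun hblock j).symm)
  refine lt_of_le_of_ne ?_ fun h => hij.ne ((Tuple.sort key).injective (p.injective h))
  rcases Prod.Lex.le_iff.mp (hkey hij.le) with h | h
  · exact absurd hb' h.ne
  · exact h.2


/-- Any permutation of `Fin (2*n)` factors as `p = q ∘ r` where `r` maps the first half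
`{i : (i : ℕ) < n}` onto itself, and `q` is an interleave with respect to the split at `n`,
i.e. `q` is strictly increasing on `{i : (i : ℕ) < n}` and on `{i : n ≤ (i : ℕ)}`. -/
theorem interleave_factorization (n : ℕ) (hn : 1 ≤ n) (p : Equiv.Perm (Fin (2 * n))) :
    ∃ q r : Equiv.Perm (Fin (2 * n)),
      (∀ i, p i = q (r i)) ∧
      ((fun i => r i) '' {i : Fin (2 * n) | (i : ℕ) < n} = {i : Fin (2 * n) | (i : ℕ) < n}) ∧
      (∀ i j : Fin (2 * n), (i : ℕ) < n → (j : ℕ) < n → (i : ℕ) < (j : ℕ) →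
        ((q i : ℕ) < (q j : ℕ))) ∧
      (∀ i j : Fin (2 * n), n ≤ (i : ℕ) → n ≤ (j : ℕ) → (i : ℕ) < (j : ℕ) →
        ((q i : ℕ) < (q j : ℕ))) := by
  obtain ⟨σ, hσ, hp⟩ := exists_perm_strictMonoOn_blocks n p
  refine ⟨σ.trans p, σ.symm, fun i => by simp, ?_, fun i j hi hj hij => ?_,
    fun i j hi hj hij => hp i j (iff_of_true hi hj) hij⟩
  · ext i
    simp only [Set.mem_image_equiv, Equiv.symm_symm, Set.mem_ofPred_eq]
    simpa using (hσ i).not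
  · exact hp i j (iff_of_false hi.not_ge hj.not_ge) hij
end

section
/- For every natural number k and every permutation p of Fin (2^k), there exist permutations q_0, q_1, …, q_{k-1} of Fin (2^k) such that p = q_0 ∘ q_1 ∘ ⋯ ∘ q_{k-1}, where for each ℓ ∈ {0,…,k-1} the permutation q_ℓ maps each dyadic block {i : (i : ℕ) / 2^(k-ℓ) = t} (for every t, with natural-number floor division) to itself, and q_ℓ is strictly increasing on each half-block {i : (i : ℕ) / 2^(k-ℓ-1) = s} (for every s). -/
/-- Sorting the values of `p` inside each block `{i : i / b = t}` is achieved by precomposing with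
a permutation that preserves the blocks. -/
theorem exists_perm_sort_blocks {n : ℕ} (b : ℕ) (p : Equiv.Perm (Fin n)) :
    ∃ s : Equiv.Perm (Fin n), (∀ i, (s i : ℕ) / b = (i : ℕ) / b) ∧
      ∀ i j : Fin n, (i : ℕ) / b = (j : ℕ) / b → i < j → p (s i) < p (s j) := by
  let f : Fin n → ℕ ×ₗ Fin n := fun i => toLex ((i : ℕ) / b, p i)
  let g : Fin n → ℕ := fun i => (i : ℕ) / b
  have hf : Monotone (f ∘ Tuple.sort f) := Tuple.monotone_sort f
  have hgs : Monotone (g ∘ Tuple.sort f) := fun i j hij =>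
    Prod.Lex.monotone_fst _ _ (hf hij)
  have hg : Monotone (g ∘ Equiv.refl (Fin n)) := fun i j hij =>
    Nat.div_le_div_right (Fin.le_def.mp hij)
  have hblock : ∀ i, (Tuple.sort f i : ℕ) / b = (i : ℕ) / b :=
    congrFun (Tuple.unique_monotone hgs hg)
  refine ⟨Tuple.sort f, hblock, fun i j hb hij => ?_⟩
  refine lt_of_le_of_ne ?_ fun h => hij.ne ((Tuple.sort f).injective (p.injective h))
  rcases Prod.Lex.toLex_le_toLex.mp (hf hij.le) with h | h
  · simp only [hblock, hb, lt_irrefl] at h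
  · exact h.2

/-- A permutation preserving the blocks of size `2 ^ m` is a product of `m` layers of interleaves,
the layers acting on blocks of successively halved size. -/
theorem exists_interleave_layers {n : ℕ} (m : ℕ) (p : Equiv.Perm (Fin n))
    (hp : ∀ i, (p i : ℕ) / 2 ^ m = (i : ℕ) / 2 ^ m) :
    ∃ qs : Fin m → Equiv.Perm (Fin n),
      p = (List.ofFn qs).prod ∧
      (∀ ℓ : Fin m, ∀ i : Fin n,
        ((qs ℓ i : ℕ) / 2 ^ (m - (ℓ : ℕ))) = ((i : ℕ) / 2 ^ (m - (ℓ : ℕ)))) ∧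
      (∀ ℓ : Fin m, ∀ i j : Fin n,
        (i : ℕ) / 2 ^ (m - (ℓ : ℕ) - 1) = (j : ℕ) / 2 ^ (m - (ℓ : ℕ) - 1) →
        (i : ℕ) < (j : ℕ) → ((qs ℓ i : ℕ) < (qs ℓ j : ℕ))) := by
  induction m generalizing p with
  | zero =>
    refine ⟨Fin.elim0, ?_, fun ℓ => ℓ.elim0, fun ℓ => ℓ.elim0⟩
    ext i
    simpa using hp i
  | succ m ih =>
    obtain ⟨s, hs, hmono⟩ := exists_perm_sort_blocks (2 ^ m) p
    obtain ⟨qs, hprod, hblock, hincr⟩ := ih s⁻¹ fun i => by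
      simpa using (hs (s⁻¹ i)).symm
    refine ⟨Fin.cons (p * s) qs, ?_, fun ℓ => ?_, fun ℓ => ?_⟩
    · simp [List.ofFn_succ, ← hprod]
    · refine Fin.cases (fun i => ?_) (fun ℓ i => ?_) ℓ
      · simp only [Fin.cons_zero, Equiv.Perm.mul_apply, Fin.val_zero, Nat.sub_zero, hp]
        rw [pow_succ, ← Nat.div_div_eq_div_mul, hs, Nat.div_div_eq_div_mul]
      · simpa using hblock ℓ i
    · refine Fin.cases (fun i j hb hij => ?_) (fun ℓ i j hb hij => ?_) ℓ
      · exact hmono i j (by simpa using hb) hij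
      · exact hincr ℓ i j (by simpa using hb) hij

/-- Any permutation of `Fin (2^k)` decomposes into `k` layers `p = q_0 ∘ q_1 ∘ ⋯ ∘ q_{k-1}`,
where each `q_ℓ` preserves every dyadic block `{i : i / 2^(k-ℓ) = t}` and is strictly
increasing on every half-block `{i : i / 2^(k-ℓ-1) = s}`. -/
theorem mergesort_interleave_decomposition (k : ℕ) (p : Equiv.Perm (Fin (2 ^ k))) :
    ∃ qs : Fin k → Equiv.Perm (Fin (2 ^ k)),
      p = (List.ofFn qs).prod ∧
      (∀ ℓ : Fin k, ∀ i : Fin (2 ^ k),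
        ((qs ℓ i : ℕ) / 2 ^ (k - (ℓ : ℕ))) = ((i : ℕ) / 2 ^ (k - (ℓ : ℕ)))) ∧
      (∀ ℓ : Fin k, ∀ i j : Fin (2 ^ k),
        (i : ℕ) / 2 ^ (k - (ℓ : ℕ) - 1) = (j : ℕ) / 2 ^ (k - (ℓ : ℕ) - 1) →
        (i : ℕ) < (j : ℕ) → ((qs ℓ i : ℕ) < (qs ℓ j : ℕ))) := by
  exact exists_interleave_layers k p fun i => by
    rw [Nat.div_eq_of_lt (p i).isLt, Nat.div_eq_of_lt i.isLt]
end

section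
/- Let p be a permutation of Fin N and let a ≤ N be such that p is strictly increasing on {i : (i : ℕ) < a} and strictly increasing on {i : a ≤ (i : ℕ)}. Then for every i with (i : ℕ) < a, the set of indices j such that exactly one of the two propositions (j < i) and (p j < p i) holds is equal to the set {j : a ≤ (j : ℕ) ∧ p j < p i}. -/
/-- For an interleave permutation `p` with split at `a`, for any mode `i` in the first
group, the symmetric difference of left sets `{j | exactly one of (j < i), (p j < p i)}`
equals `{j | a ≤ j ∧ p j < p i}`. -/
theorem interleave_symmDiff_left_sets {N : ℕ} (p : Equiv.Perm (Fin N)) (a : ℕ) (ha : a ≤ N)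
    (h₁ : ∀ i j : Fin N, (i : ℕ) < a → (j : ℕ) < a → (i : ℕ) < (j : ℕ) →
      ((p i : ℕ) < (p j : ℕ)))
    (h₂ : ∀ i j : Fin N, a ≤ (i : ℕ) → a ≤ (j : ℕ) → (i : ℕ) < (j : ℕ) →
      ((p i : ℕ) < (p j : ℕ))) :
    ∀ i : Fin N, (i : ℕ) < a →
      {j : Fin N | Xor' ((j : ℕ) < (i : ℕ)) ((p j : ℕ) < (p i : ℕ))} =
      {j : Fin N | a ≤ (j : ℕ) ∧ (p j : ℕ) < (p i : ℕ)} := by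
  intro i hi
  ext j
  change Xor ((j : ℕ) < (i : ℕ)) ((p j : ℕ) < (p i : ℕ)) ↔ a ≤ (j : ℕ) ∧ (p j : ℕ) < (p i : ℕ)
  rw [xor_def]
  rcases lt_or_ge (j : ℕ) a with hj | hj
  · rcases lt_trichotomy (j : ℕ) (i : ℕ) with h | h | h
    · have := h₁ j i hj hi h
      omega
    · obtain rfl := Fin.ext h
      omega
    · have := h₁ i j hi hj h
      omega
  · omega
end

section
/- Let L_r, L_c be positive natural numbers, and let r, r' < L_r and c, c' < L_c. Then the conjunction (r * L_c + c < r' * L_c + c') ∧ (c' * L_r + r' < c * L_r + r) holds if and only if r < r' and c' < c. -/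
theorem Nat.mul_add_lt_mul_add_iff_lex {n a a' b b' : ℕ} (hb : b < n) (hb' : b' < n) :
    a * n + b < a' * n + b' ↔ a < a' ∨ a = a' ∧ b < b' := by
  rcases lt_trichotomy a a' with h | rfl | h
  · have := Nat.mul_le_mul_right n (Nat.succ_le_of_lt h)
    rw [Nat.succ_mul] at this
    omega
  · omega
  · have := Nat.mul_le_mul_right n (Nat.succ_le_of_lt h)
    rw [Nat.succ_mul] at this
    omega

/-- Crossing condition for the 2D reflection: on an `L_r × L_c` grid, two modes `(r,c)`
and `(r',c')` satisfy `m₀(r,c) < m₀(r',c')` (row-major) and `m₁(r',c') < m₁(r,c)`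
(column-major) iff `r < r'` and `c' < c`. -/
theorem twoD_reflection_crossing (Lr Lc : ℕ) (hLr : 0 < Lr) (hLc : 0 < Lc)
    (r r' c c' : ℕ) (hr : r < Lr) (hr' : r' < Lr) (hc : c < Lc) (hc' : c' < Lc) :
    ((r * Lc + c < r' * Lc + c') ∧ (c' * Lr + r' < c * Lr + r)) ↔ (r < r' ∧ c' < c) := by
  rw [Nat.mul_add_lt_mul_add_iff_lex hc hc', Nat.mul_add_lt_mul_add_iff_lex hr' hr]
  omega
end

section
/- Let N ≥ 1 and let 𝕃 be the N×N strict lower-triangular all-ones matrix over ZMod 2 (entries 𝕃 i j = 1 if j < i, else 0). Then there exist an N×N matrix R₂ over ZMod 2 and a list L of transvection structures on the index type Fin N ⊕ Fin N over ZMod 2 with L.length ≤ 2*N, such that the product of the associated transvection matrices equals the block matrix fromBlocks 1 0 𝕃 R₂. -/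
open Matrix

/-- The `n × n` strict lower-triangular all-ones matrix over `ZMod 2`. -/
def strictLowerOnes (n : ℕ) : Matrix (Fin n) (Fin n) (ZMod 2) :=
  Matrix.of fun i j => if j < i then 1 else 0

section BlockTransvection

variable {m n R : Type*} [Fintype m] [Fintype n] [DecidableEq m] [DecidableEq n] [CommRing R]

theorem transvection_inr_inr_mul_fromBlocks_one_zero (i j : n) (c : R)
    (A : Matrix n m R) (D : Matrix n n R) :
    transvection (Sum.inr i) (Sum.inr j) c * fromBlocks (1 : Matrix m m R) 0 A D =
      fromBlocks 1 0 (transvection i j c * A) (transvection i j c * D) := by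
  have h : transvection (Sum.inr i : m ⊕ n) (Sum.inr j) c =
      fromBlocks 1 0 0 (transvection i j c) := by
    ext (a | a) (b | b) <;> simp [transvection, single_apply, one_apply]
  simp [h, fromBlocks_multiply]

theorem transvection_inr_inl_mul_fromBlocks_one_zero (i : n) (j : m) (c : R)
    (A : Matrix n m R) (D : Matrix n n R) :
    transvection (Sum.inr i) (Sum.inl j) c * fromBlocks (1 : Matrix m m R) 0 A D =
      fromBlocks 1 0 (A + single i j c) D := by
  have h : transvection (Sum.inr i : m ⊕ n) (Sum.inl j) c =
      fromBlocks 1 0 (single i j c) 1 := by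
    ext (a | a) (b | b) <;> simp [transvection, single_apply, one_apply]
  simp [h, fromBlocks_multiply, add_comm]

end BlockTransvection

/-- The matrix `strictLowerOnes n` with all rows of index greater than `k` replaced by zero. -/
def truncatedStrictLowerOnes (n k : ℕ) : Matrix (Fin n) (Fin n) (ZMod 2) :=
  Matrix.of fun i j => if j < i ∧ (i : ℕ) ≤ k then 1 else 0

theorem truncatedStrictLowerOnes_zero (n : ℕ) : truncatedStrictLowerOnes n 0 = 0 := by
  ext i j
  simp only [truncatedStrictLowerOnes, of_apply, Fin.lt_def, Matrix.zero_apply, ite_eq_right_iff]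
  omega

theorem truncatedStrictLowerOnes_of_le {n k : ℕ} (h : n ≤ k + 1) :
    truncatedStrictLowerOnes n k = strictLowerOnes n := by
  ext i j
  have hi : (i : ℕ) ≤ k := by omega
  simp [truncatedStrictLowerOnes, strictLowerOnes, hi]

theorem truncatedStrictLowerOnes_succ {n k : ℕ} (h : k + 1 < n) :
    truncatedStrictLowerOnes n (k + 1) =
      transvection ⟨k + 1, h⟩ ⟨k, by omega⟩ 1 * truncatedStrictLowerOnes n k +
        single ⟨k + 1, h⟩ ⟨k, by omega⟩ 1 := by
  ext i j
  rw [Matrix.add_apply]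
  by_cases hi : i = ⟨k + 1, h⟩
  · subst hi
    rw [transvection_mul_apply_same]
    simp only [truncatedStrictLowerOnes, of_apply, single_apply, Fin.lt_def, Fin.ext_iff]
    rcases lt_trichotomy (j : ℕ) k with hj | hj | hj
    · simp [hj, hj.ne', hj.trans (Nat.lt_succ_self k)]
    · simp [hj]
    · simp [hj.ne, hj.not_gt, Nat.not_lt.mpr (Nat.succ_le_of_lt hj)]
  · rw [transvection_mul_apply_of_ne _ _ _ _ hi, single_apply_of_row_ne (Ne.symm hi), add_zero]
    have hik : (i : ℕ) ≤ k + 1 ↔ (i : ℕ) ≤ k := by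
      have hne : (i : ℕ) ≠ k + 1 := fun hval => hi (Fin.ext hval)
      omega
    simp [truncatedStrictLowerOnes, hik]

theorem exists_transvections_truncatedStrictLowerOnes (n k : ℕ) (hk : k < n) :
    ∃ (D : Matrix (Fin n) (Fin n) (ZMod 2))
      (L : List (TransvectionStruct (Fin n ⊕ Fin n) (ZMod 2))),
      L.length = 2 * k ∧
      (L.map TransvectionStruct.toMatrix).prod =
        fromBlocks 1 0 (truncatedStrictLowerOnes n k) D := by
  induction k with
  | zero => exact ⟨1, [], rfl, by simp [truncatedStrictLowerOnes_zero]⟩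
  | succ k ih =>
    obtain ⟨D, L, hlen, hprod⟩ := ih (by omega)
    refine ⟨transvection ⟨k + 1, hk⟩ ⟨k, by omega⟩ 1 * D,
      ⟨Sum.inr ⟨k + 1, hk⟩, Sum.inl ⟨k, by omega⟩, by simp, 1⟩ ::
        ⟨Sum.inr ⟨k + 1, hk⟩, Sum.inr ⟨k, by omega⟩, by simp, 1⟩ :: L, ?_, ?_⟩
    · simp only [List.length_cons, hlen]
      omega
    · simp only [List.map_cons, List.prod_cons, hprod, TransvectionStruct.toMatrix_mk]
      rw [transvection_inr_inr_mul_fromBlocks_one_zero,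
        transvection_inr_inl_mul_fromBlocks_one_zero, truncatedStrictLowerOnes_succ hk]

/-- The CNOT circuit for the 1D reflection: the block matrix with identity upper-left
block, zero upper-right block and lower-left block `𝕃` (strict lower-triangular
all-ones) can be synthesized from at most `2N` CNOT (transvection) gates. -/
theorem oneD_reflection_cnot_count (N : ℕ) (hN : 1 ≤ N) :
    ∃ (R₂ : Matrix (Fin N) (Fin N) (ZMod 2))
      (L : List (Matrix.TransvectionStruct (Fin N ⊕ Fin N) (ZMod 2))),
      L.length ≤ 2 * N ∧
      (L.map Matrix.TransvectionStruct.toMatrix).prod =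
        Matrix.fromBlocks 1 0 (strictLowerOnes N) R₂ := by
  obtain ⟨D, L, hlen, hprod⟩ :=
    exists_transvections_truncatedStrictLowerOnes N (N - 1) (by omega)
  refine ⟨D, L, by omega, ?_⟩
  rw [hprod, truncatedStrictLowerOnes_of_le (by omega)]
end

section
/- Let L_r, L_c ≥ 1 and set N = L_r * L_c. Let 𝕃_n denote the n×n strict lower-triangular all-ones matrix over ZMod 2, and let B = 𝕃_{L_r} ⊗ₖ 𝕃_{L_c} be the Kronecker product, an N×N matrix on index type Fin L_r × Fin L_c. Then there exist a matrix R₂ over ZMod 2 and a list L of transvection structures on the index type (Fin L_r × Fin L_c) ⊕ (Fin L_r × Fin L_c) over ZMod 2 with L.length ≤ 4*N, such that the product of the associated transvection matrices equals the block matrix fromBlocks 1 0 B R₂. -/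
open Matrix Kronecker

/-- `M` is a product of at most `k` transvections. -/
def IsTransvectionProd {n R : Type*} [Fintype n] [DecidableEq n] [CommRing R]
    (M : Matrix n n R) (k : ℕ) : Prop :=
  ∃ L : List (TransvectionStruct n R),
    L.length ≤ k ∧ (L.map TransvectionStruct.toMatrix).prod = M

namespace IsTransvectionProd

variable {n m ι R : Type*} [Fintype n] [DecidableEq n] [Fintype m] [DecidableEq m] [CommRing R]

theorem one (k : ℕ) : IsTransvectionProd (1 : Matrix n n R) k :=
  ⟨[], by simp, by simp⟩

theorem mono {M : Matrix n n R} {k l : ℕ} (h : IsTransvectionProd M k) (hkl : k ≤ l) :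
    IsTransvectionProd M l := by
  obtain ⟨L, hL, hM⟩ := h
  exact ⟨L, hL.trans hkl, hM⟩

theorem mul {M M' : Matrix n n R} {k l : ℕ} (h : IsTransvectionProd M k)
    (h' : IsTransvectionProd M' l) : IsTransvectionProd (M * M') (k + l) := by
  obtain ⟨L, hL, rfl⟩ := h
  obtain ⟨L', hL', rfl⟩ := h'
  exact ⟨L ++ L', by simpa using add_le_add hL hL', by simp⟩

theorem transvection {i j : n} (hij : i ≠ j) (c : R) :
    IsTransvectionProd (Matrix.transvection i j c) 1 :=
  ⟨[⟨i, j, hij, c⟩], by simp, by simp⟩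

/-- Transvections whose targets are disjoint from their sources multiply additively. -/
theorem one_add_sum_single (s : Finset ι) (f g : ι → n) (c : R) (h : ∀ p q, f p ≠ g q) :
    IsTransvectionProd (1 + ∑ p ∈ s, Matrix.single (f p) (g p) c) s.card := by
  classical
  induction s using Finset.induction_on with
  | empty => simpa using one (R := R) (n := n) 0
  | insert a s ha ih =>
    convert ih.mul (transvection (h a a) c) using 1
    · have hz : (∑ p ∈ s, Matrix.single (f p) (g p) c) * Matrix.single (f a) (g a) c = 0 := by
        rw [Finset.sum_mul]
        exact Finset.sum_eq_zero fun p _ => single_mul_single_of_ne _ _ _ _ (h a p).symm _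
      rw [Finset.sum_insert ha, Matrix.transvection, add_mul, mul_add, mul_add, hz]
      simp only [mul_one, one_mul, add_zero]
      abel
    · rw [Finset.card_insert_of_notMem ha]

theorem reindex (e : n ≃ m) {M : Matrix n n R} {k : ℕ} (h : IsTransvectionProd M k) :
    IsTransvectionProd (M.submatrix e.symm e.symm) k := by
  obtain ⟨L, hL, rfl⟩ := h
  refine ⟨L.map (TransvectionStruct.reindexEquiv e), by simpa using hL, ?_⟩
  rw [List.map_map, TransvectionStruct.toMatrix_reindexEquiv_prod]
  rfl

theorem fromBlocks_one_left {M : Matrix n n R} {k : ℕ} (h : IsTransvectionProd M k) :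
    IsTransvectionProd (fromBlocks (1 : Matrix m m R) 0 0 M) k := by
  have key : IsTransvectionProd (fromBlocks M 0 0 (1 : Matrix m m R)) k := by
    obtain ⟨L, hL, rfl⟩ := h
    refine ⟨L.map (TransvectionStruct.sumInl m), by simpa using hL, ?_⟩
    have := TransvectionStruct.sumInl_toMatrix_prod_mul m (1 : Matrix n n R) L (1 : Matrix m m R)
    simpa using this
  convert key.reindex (Equiv.sumComm n m) using 1
  ext (i | i) (j | j) <;> simp

theorem one_kronecker {M : Matrix n n R} {k : ℕ} (h : IsTransvectionProd M k) :
    IsTransvectionProd ((1 : Matrix m m R) ⊗ₖ M) (Fintype.card m * k) := by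
  obtain ⟨L, hL, rfl⟩ := h
  refine mono ?_ (Nat.mul_le_mul_left _ hL)
  clear hL
  induction L with
  | nil => simpa using one (n := m × n) (R := R) 0
  | cons t L ih =>
    have ht := one_add_sum_single (Finset.univ : Finset m) (fun a => (a, t.i))
      (fun a => (a, t.j)) t.c (fun p q hpq => t.hij (Prod.ext_iff.1 hpq).2)
    convert ht.mul ih using 1
    · rw [List.map_cons, List.prod_cons, ← one_mul (1 : Matrix m m R), mul_kronecker_mul, one_mul]
      congr 1
      rw [TransvectionStruct.toMatrix, Matrix.transvection, kronecker_add, one_kronecker_one]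
      congr 1
      ext ⟨a, i⟩ ⟨b, j⟩
      simp only [kroneckerMap_apply, one_apply, single_apply, Matrix.sum_apply, Prod.mk.injEq]
      rw [Finset.sum_eq_single a]
      · by_cases hab : a = b <;> simp [hab]
      · intro d _ hd
        simp [hd]
      · simp
    · simp [mul_add, add_comm]

theorem kronecker_one {M : Matrix n n R} {k : ℕ} (h : IsTransvectionProd M k) :
    IsTransvectionProd (M ⊗ₖ (1 : Matrix m m R)) (Fintype.card m * k) := by
  convert (h.one_kronecker (m := m)).reindex (Equiv.prodComm m n) using 1
  ext ⟨a, i⟩ ⟨b, j⟩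
  simp [mul_comm]

/-- A lower-left block with at most one nonzero entry in each row. -/
theorem fromBlocks_shear (s : Finset m) (g : m → n) (c : R) :
    IsTransvectionProd (fromBlocks (1 : Matrix n n R) 0
      (of fun i j => if i ∈ s ∧ g i = j then c else 0) (1 : Matrix m m R)) s.card := by
  convert one_add_sum_single s (fun p => (Sum.inr p : n ⊕ m)) (fun p => Sum.inl (g p)) c
    (by simp) using 1
  ext (i | i) (j | j) <;>
    simp [one_apply, Matrix.sum_apply, single_apply, ite_and]

end IsTransvectionProd

/-- The matrix on `Fin n` replacing the entries of index at most `k` by their prefix sums. -/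
def prefixSum (n k : ℕ) : Matrix (Fin n) (Fin n) (ZMod 2) :=
  of fun i j => if i = j ∨ (j < i ∧ i.val ≤ k) then 1 else 0

theorem isTransvectionProd_prefixSum (n k : ℕ) : IsTransvectionProd (prefixSum n k) k := by
  induction k with
  | zero =>
    convert IsTransvectionProd.one (n := Fin n) (R := ZMod 2) 0
    ext i j
    have : ¬ (j < i ∧ i.val ≤ 0) := by rw [Fin.lt_def]; omega
    simp only [prefixSum, of_apply, one_apply, this, or_false]
  | succ k ih =>
    by_cases hk : k + 1 < n
    · have hne : (⟨k + 1, hk⟩ : Fin n) ≠ ⟨k, by omega⟩ := by simp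
      convert (IsTransvectionProd.transvection hne (1 : ZMod 2)).mul ih using 1
      · ext i j
        by_cases hi : i = ⟨k + 1, hk⟩
        · subst hi
          rw [transvection_mul_apply_same]
          simp only [prefixSum, of_apply, Fin.ext_iff, Fin.lt_def]
          split_ifs <;> first | omega | simp
        · rw [transvection_mul_apply_of_ne _ _ _ _ hi]
          simp only [prefixSum, of_apply, Fin.ext_iff, Fin.lt_def] at hi ⊢
          split_ifs <;> first | omega | rfl
      · omega
    · convert ih.mono k.le_succ using 1
      ext i j
      have := i.isLt
      simp only [prefixSum, of_apply]
      congr 2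
      simp only [eq_iff_iff]
      omega

/-- The subdiagonal shift matrix. -/
def lowerShift (n : ℕ) : Matrix (Fin n) (Fin n) (ZMod 2) :=
  of fun i j => if j.val + 1 = i.val then 1 else 0

theorem prefixSum_mul_lowerShift (n : ℕ) : prefixSum n n * lowerShift n = strictLowerOnes n := by
  ext i j
  simp only [mul_apply, prefixSum, lowerShift, strictLowerOnes, of_apply]
  by_cases hj : j.val + 1 < n
  · rw [Finset.sum_eq_single ⟨j.val + 1, hj⟩]
    · simp only [Fin.ext_iff, Fin.lt_def]
      split_ifs <;> first | omega | simp
    · intro b _ hb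
      exact mul_eq_zero_of_right _ (if_neg fun h => hb (Fin.ext h.symm))
    · simp
  · rw [Finset.sum_eq_zero, if_neg (by rw [Fin.lt_def]; omega)]
    intro b _
    exact mul_eq_zero_of_right _ (if_neg (by omega))

theorem isTransvectionProd_lowerShift_kronecker (a b : ℕ) :
    IsTransvectionProd (fromBlocks 1 0 (lowerShift a ⊗ₖ lowerShift b) 1) (a * b) := by
  let g : Fin a × Fin b → Fin a × Fin b := fun p =>
    (⟨p.1.val - 1, by omega⟩, ⟨p.2.val - 1, by omega⟩)
  let s : Finset (Fin a × Fin b) := {p | 0 < p.1.val ∧ 0 < p.2.val}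
  have hs : s.card ≤ a * b := by simpa using s.card_le_univ
  convert (IsTransvectionProd.fromBlocks_shear s g (1 : ZMod 2)).mono hs using 2
  ext i j
  simp only [kroneckerMap_apply, lowerShift, of_apply, mul_ite, mul_one, mul_zero, ← ite_and]
  congr 1
  simp only [s, g, Finset.mem_filter, Finset.mem_univ, true_and, Prod.ext_iff, Fin.ext_iff,
    eq_iff_iff]
  omega

/-- The CNOT circuit for the 2D reflection on an `L_r × L_c` grid: the block matrix with
lower-left block the crossing matrix `B = 𝕃_{L_r} ⊗ₖ 𝕃_{L_c}` can be synthesized from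
at most `4N` CNOT (transvection) gates, where `N = L_r * L_c`. -/
theorem twoD_reflection_cnot_count (Lr Lc : ℕ) (hLr : 1 ≤ Lr) (hLc : 1 ≤ Lc) :
    ∃ (R₂ : Matrix (Fin Lr × Fin Lc) (Fin Lr × Fin Lc) (ZMod 2))
      (L : List (Matrix.TransvectionStruct
        ((Fin Lr × Fin Lc) ⊕ (Fin Lr × Fin Lc)) (ZMod 2))),
      L.length ≤ 4 * (Lr * Lc) ∧
      (L.map Matrix.TransvectionStruct.toMatrix).prod =
        Matrix.fromBlocks 1 0 (strictLowerOnes Lr ⊗ₖ strictLowerOnes Lc) R₂ := by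
  have hT := ((isTransvectionProd_prefixSum Lr Lr).kronecker_one (m := Fin Lc)).mul
    ((isTransvectionProd_prefixSum Lc Lc).one_kronecker (m := Fin Lr))
  rw [← mul_kronecker_mul, mul_one, one_mul] at hT
  obtain ⟨L, hL, hprod⟩ := (hT.fromBlocks_one_left (m := Fin Lr × Fin Lc)).mul
    (isTransvectionProd_lowerShift_kronecker Lr Lc)
  refine ⟨prefixSum Lr Lr ⊗ₖ prefixSum Lc Lc, L, hL.trans ?_, hprod.trans ?_⟩
  · simp only [Fintype.card_fin]
    linarith [Nat.mul_comm Lr Lc, Nat.zero_le (Lr * Lc)]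
  · simp [fromBlocks_multiply, ← mul_kronecker_mul, prefixSum_mul_lowerShift]
end

section
/- Let N, N' be natural numbers with N' ≥ 1, let σ : Fin N' → Fin N be any function, and let B be the N×N' matrix over ZMod 2 with B j i = 1 if j = σ i and 0 otherwise. Then there exist a matrix R₂ over ZMod 2 and a list L of transvection structures on the index type Fin N' ⊕ Fin N over ZMod 2 with L.length ≤ N', such that the product of the associated transvection matrices equals the block matrix fromBlocks 1 0 B R₂. -/
open Matrix

/-- A product of transvections adding coordinates of the left summand to coordinates of the right
summand is block lower unitriangular, and its lower left block is the sum of the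
corresponding matrix units. -/
theorem prod_map_transvection_inr_inl {m n R : Type*} [Fintype m] [Fintype n]
    [DecidableEq m] [DecidableEq n] [CommRing R] (σ : m → n) (l : List m) :
    (l.map fun i => transvection (Sum.inr (σ i)) (Sum.inl i) (1 : R)).prod =
      fromBlocks 1 0 (l.map fun i => single (σ i) i (1 : R)).sum 1 := by
  induction l with
  | nil => simp
  | cons i l ih =>
    have h : transvection (Sum.inr (σ i)) (Sum.inl i) (1 : R) =
        fromBlocks 1 0 (single (σ i) i 1) 1 := by
      ext (a | a) (b | b) <;> simp [transvection, one_apply, single_apply]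
    simp [ih, h, fromBlocks_multiply]

/-- The selection matrix `B` of a deformation map `σ : Fin N' → Fin N` (each column a
standard basis vector) can be realized by a CNOT circuit with at most `N'` gates:
the block matrix `fromBlocks 1 0 B R₂` is a product of at most `N'` transvections. -/
theorem deformation_cnot_count (N N' : ℕ) (hN' : 1 ≤ N') (σ : Fin N' → Fin N)
    (B : Matrix (Fin N) (Fin N') (ZMod 2))
    (hB : ∀ (j : Fin N) (i : Fin N'), B j i = if j = σ i then 1 else 0) :
    ∃ (R₂ : Matrix (Fin N) (Fin N) (ZMod 2))
      (L : List (Matrix.TransvectionStruct (Fin N' ⊕ Fin N) (ZMod 2))),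
      L.length ≤ N' ∧
      (L.map Matrix.TransvectionStruct.toMatrix).prod = Matrix.fromBlocks 1 0 B R₂ := by
  refine ⟨1, (List.finRange N').map fun i => ⟨Sum.inr (σ i), Sum.inl i, Sum.inr_ne_inl, 1⟩,
    by simp, ?_⟩
  have hsum : ((List.finRange N').map fun i => single (σ i) i (1 : ZMod 2)).sum = B := by
    rw [← List.ofFn_eq_map, List.sum_ofFn]
    ext j i
    rw [Matrix.sum_apply, Finset.sum_eq_single i]
    · simp [single_apply, hB, eq_comm]
    · intro k _ hk
      simp [hk]
    · simp
  rw [List.map_map, ← hsum, ← prod_map_transvection_inr_inl]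
  rfl
end
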